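/- Let N ≥ 1 and let a₁, …, a_N be nonnegative integers with a_N > 0. Let D be the tensor product, over n = 1, …, N, of a_n copies of K_n. Then υ²(D) = −2N. Consequently, the complexes K_n, n ≥ 1, are linearly independent in the group of stable equivalence classes of model knot complexes under tensor product. -/

import Mathlib

open scoped BigOperators

/-- A "pre-complex": a finite distinguished basis `B`, a grading `gr`,
bifiltration functions `alg` and `alex`, and a differential recorded by its
matrix `d` over the field `F₂ = ZMod 2`:  `∂ x = ∑ y, d x y • y`. -/
structure PreComplex where
  B : Type
  fB : Fintype B
  dB : DecidableEq B
  gr : B → ℤ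
  alg : B → ℤ
  alex : B → ℤ
  d : B → B → ZMod 2

attribute [instance] PreComplex.fB PreComplex.dB

namespace PreComplex

variable (C : PreComplex)

/-- Chains: F₂-linear combinations of basis elements. -/
abbrev Chain : Type := C.B → ZMod 2

/-- The boundary of a chain, extending `∂ x = ∑ y, d x y • y` linearly. -/
def bdry (c : C.Chain) : C.Chain := fun y => ∑ x, c x * C.d x y

/-- A chain is homogeneous of grading `k`. -/
def isGraded (c : C.Chain) (k : ℤ) : Prop := ∀ x, c x ≠ 0 → C.gr x = k

def isCycle (c : C.Chain) : Prop := C.bdry c = 0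

def isBoundary (c : C.Chain) : Prop := ∃ w : C.Chain, C.bdry w = c

/-- A cycle of grading 0 representing the nonzero class of `H₀(C)`. -/
def GenCycle (z : C.Chain) : Prop :=
  C.isCycle z ∧ C.isGraded z 0 ∧ ¬ C.isBoundary z

/-- The bifiltration level of a basis element. -/
def lev (x : C.B) : ℤ × ℤ := (C.alg x, C.alex x)

/-- A model knot complex: `∂ ∘ ∂ = 0`; `∂` drops the grading by one and does
not increase either filtration; the homology is one dimensional, concentrated
in grading 0; and the minimum over cycles representing the generator of
`H₀(C)` of their maximal `alg` (resp. `alex`) filtration level is 0. -/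
def IsModel : Prop :=
  (∀ x z, (∑ y, C.d x y * C.d y z) = 0) ∧
  (∀ x y, C.d x y ≠ 0 → C.gr y = C.gr x - 1 ∧ C.alg y ≤ C.alg x ∧ C.alex y ≤ C.alex x) ∧
  (∀ k : ℤ, k ≠ 0 → ∀ z : C.Chain, C.isCycle z → C.isGraded z k → C.isBoundary z) ∧
  (∃ z : C.Chain, C.GenCycle z) ∧
  (∀ z z' : C.Chain, C.GenCycle z → C.GenCycle z' → C.isBoundary (z + z')) ∧
  (∃ z : C.Chain, C.GenCycle z ∧ ∀ x, z x ≠ 0 → C.alg x ≤ 0) ∧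
  (∀ z : C.Chain, C.GenCycle z → ∃ x, z x ≠ 0 ∧ 0 ≤ C.alg x) ∧
  (∃ z : C.Chain, C.GenCycle z ∧ ∀ x, z x ≠ 0 → C.alex x ≤ 0) ∧
  (∀ z : C.Chain, C.GenCycle z → ∃ x, z x ≠ 0 ∧ 0 ≤ C.alex x)

/-- An acyclic complex: conditions (i) and (ii) hold but the homology vanishes. -/
def IsAcyclic : Prop :=
  (∀ x z, (∑ y, C.d x y * C.d y z) = 0) ∧
  (∀ x y, C.d x y ≠ 0 → C.gr y = C.gr x - 1 ∧ C.alg y ≤ C.alg x ∧ C.alex y ≤ C.alex x) ∧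
  (∀ z : C.Chain, C.isCycle z → C.isBoundary z)

end PreComplex

/-- `f_t(i,j) = (t/2)·j + (1 − t/2)·i`. -/
noncomputable def fval (t : ℝ) (p : ℤ × ℤ) : ℝ :=
  (t / 2) * (p.2 : ℝ) + (1 - t / 2) * (p.1 : ℝ)

namespace PreComplex

variable (C : PreComplex)

/-- A chain lies in the subcomplex `F_{t,s}`. -/
def inF (t s : ℝ) (c : C.Chain) : Prop :=
  ∀ x, c x ≠ 0 → fval t (C.lev x) ≤ s

/-- `γ_C(t)`: the minimal `s` such that `H₀(F_{t,s}) → H₀(C)` is surjective,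
i.e. such that `F_{t,s}` contains a cycle representing the generator. -/
noncomputable def gamma (t : ℝ) : ℝ :=
  sInf {s : ℝ | ∃ z : C.Chain, C.GenCycle z ∧ C.inF t s z}

/-- The Upsilon invariant `Υ_C(t) = −2 γ_C(t)`. -/
noncomputable def Upsilon (t : ℝ) : ℝ := -2 * C.gamma t

/-- `P`: the set of bifiltration levels of basis elements. -/
def PSet : Set (ℤ × ℤ) := Set.range C.lev

/-- `P_u = { p ∈ P : f_u(p) = γ_C(u) }`. -/
def Pt (u : ℝ) : Set (ℤ × ℤ) := {p ∈ C.PSet | fval u p = C.gamma u}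

/-- `p` is the negative pivot point of `C` at `t`. -/
def IsNegPivot (t : ℝ) (p : ℤ × ℤ) : Prop :=
  ∃ δ₀ > (0 : ℝ), ∀ δ : ℝ, 0 < δ → δ < δ₀ → C.Pt (t - δ) ∩ C.Pt t = {p}

/-- `p` is the positive pivot point of `C` at `t`. -/
def IsPosPivot (t : ℝ) (p : ℤ × ℤ) : Prop :=
  ∃ δ₀ > (0 : ℝ), ∀ δ : ℝ, 0 < δ → δ < δ₀ → C.Pt (t + δ) ∩ C.Pt t = {p}

/-- Cycles in `F_{t−δ, γ_C(t−δ)}` representing the nonzero class of `H₀(C)`. -/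
def ZminusAt (t δ : ℝ) : Set C.Chain :=
  {z | C.GenCycle z ∧ C.inF (t - δ) (C.gamma (t - δ)) z}

/-- Cycles in `F_{t+δ, γ_C(t+δ)}` representing the nonzero class of `H₀(C)`. -/
def ZplusAt (t δ : ℝ) : Set C.Chain :=
  {z | C.GenCycle z ∧ C.inF (t + δ) (C.gamma (t + δ)) z}

/-- `Z⁻`: the (eventual, for all sufficiently small `δ > 0`) set of cycles in
`F_{t−δ, γ_C(t−δ)}` representing the nonzero class of `H₀(C)`. -/
def Zminus (t : ℝ) : Set C.Chain :=
  {z | ∃ δ₀ > (0 : ℝ), ∀ δ : ℝ, 0 < δ → δ < δ₀ → z ∈ C.ZminusAt t δ}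

/-- `Z⁺`: the (eventual, for all sufficiently small `δ > 0`) set of cycles in
`F_{t+δ, γ_C(t+δ)}` representing the nonzero class of `H₀(C)`. -/
def Zplus (t : ℝ) : Set C.Chain :=
  {z | ∃ δ₀ > (0 : ℝ), ∀ δ : ℝ, 0 < δ → δ < δ₀ → z ∈ C.ZplusAt t δ}

/-- A basis element lies in the subcomplex `F_{t,γ_C(t)} + F_{s,r}`. -/
def inRegion (t s r : ℝ) (x : C.B) : Prop :=
  fval t (C.lev x) ≤ C.gamma t ∨ fval s (C.lev x) ≤ r

/-- `z` and `z'` represent the same homology class in `H₀(F_{t,γ_C(t)} + F_{s,r})`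
(over F₂ the difference `z − z'` is `z + z'`). -/
def sameClass (t s r : ℝ) (z z' : C.Chain) : Prop :=
  (∀ x, z x ≠ 0 → C.inRegion t s r x) ∧
  (∀ x, z' x ≠ 0 → C.inRegion t s r x) ∧
  ∃ w : C.Chain, (∀ x, w x ≠ 0 → C.inRegion t s r x) ∧ C.bdry w = z + z'

/-- The set of `r` for which some `z⁻ ∈ Z⁻` and `z⁺ ∈ Z⁺` represent the same
class in `H₀(F_{t,γ_C(t)} + F_{s,r})`. -/
def gamma2Set (t s : ℝ) : Set ℝ :=
  {r | ∃ zm ∈ C.Zminus t, ∃ zp ∈ C.Zplus t, C.sameClass t s r zm zp}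

/-- `γ²_{C,t}(s)`, as an extended real: the minimum of `gamma2Set`
(`−∞` if the condition holds for every `r`). -/
noncomputable def gamma2 (t s : ℝ) : EReal :=
  sInf ((fun r : ℝ => (r : EReal)) '' C.gamma2Set t s)

/-- `Υ²_{C,t}(s) = −2 (γ²_{C,t}(s) − γ_C(t))`. -/
noncomputable def Upsilon2 (t s : ℝ) : EReal :=
  (-2 : EReal) * (C.gamma2 t s - (C.gamma t : EReal))

end PreComplex

/-- The jump of the derivative of `f` at `t`: the right-hand derivative minus
the left-hand derivative. -/
noncomputable def derivJump (f : ℝ → ℝ) (t : ℝ) : ℝ :=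
  derivWithin f (Set.Ici t) t - derivWithin f (Set.Iic t) t

/-- Direct sum of two pre-complexes. -/
def PreComplex.dsum (C A : PreComplex) : PreComplex where
  B := C.B ⊕ A.B
  fB := inferInstance
  dB := inferInstance
  gr := Sum.elim C.gr A.gr
  alg := Sum.elim C.alg A.alg
  alex := Sum.elim C.alex A.alex
  d := fun x y =>
    match x, y with
    | Sum.inl x, Sum.inl y => C.d x y
    | Sum.inr x, Sum.inr y => A.d x y
    | _, _ => 0

/-- Tensor product of two pre-complexes. -/
def PreComplex.tensor (C₁ C₂ : PreComplex) : PreComplex where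
  B := C₁.B × C₂.B
  fB := inferInstance
  dB := inferInstance
  gr := fun x => C₁.gr x.1 + C₂.gr x.2
  alg := fun x => C₁.alg x.1 + C₂.alg x.2
  alex := fun x => C₁.alex x.1 + C₂.alex x.2
  d := fun x y =>
    (if x.2 = y.2 then C₁.d x.1 y.1 else 0) + (if x.1 = y.1 then C₂.d x.2 y.2 else 0)

/-- An isomorphism of pre-complexes: a bijection of the distinguished bases
preserving `gr`, `alg`, `alex`, whose linear extension commutes with the
differentials. -/
def PreComplex.Iso (C₁ C₂ : PreComplex) : Prop :=
  ∃ e : C₁.B ≃ C₂.B,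
    (∀ x, C₂.gr (e x) = C₁.gr x) ∧
    (∀ x, C₂.alg (e x) = C₁.alg x) ∧
    (∀ x, C₂.alex (e x) = C₁.alex x) ∧
    (∀ x y, C₂.d (e x) (e y) = C₁.d x y)

/-- Stable equivalence of pre-complexes: isomorphism after adding acyclic
summands. -/
def PreComplex.StablyEquiv (C₁ C₂ : PreComplex) : Prop :=
  ∃ A₁ A₂ : PreComplex, A₁.IsAcyclic ∧ A₂.IsAcyclic ∧ (C₁.dsum A₁).Iso (C₂.dsum A₂)

/-- The model complex `K_n` with basis `a, b, c, x, y` (indices 0–4):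
`a, b, c` of grading 0 at levels (−n, n), (0, 0), (n, −n); `x` of grading 1
at level (n, n); `y` of grading −1 at level (−n, −n); differential
`∂x = a + c`, `∂a = ∂b = ∂c = y`, `∂y = 0`. -/
def Kc (n : ℕ) : PreComplex where
  B := Fin 5
  fB := inferInstance
  dB := inferInstance
  gr := ![0, 0, 0, 1, -1]
  alg := ![-(n : ℤ), 0, (n : ℤ), (n : ℤ), -(n : ℤ)]
  alex := ![(n : ℤ), 0, -(n : ℤ), (n : ℤ), -(n : ℤ)]
  d := fun x y =>
    if (x.val = 3 ∧ (y.val = 0 ∨ y.val = 2)) ∨ (x.val ≤ 2 ∧ y.val = 4)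
    then 1 else 0

/-- The model complex `−K_n` with basis `a, b, c, x, y` (indices 0–4):
`a, b, c` of grading 0 at levels (n, −n), (0, 0), (−n, n); `x` of grading −1
at level (−n, −n); `y` of grading 1 at level (n, n); differential
`∂y = a + b + c`, `∂a = ∂c = x`, `∂b = ∂x = 0`. -/
def mKc (n : ℕ) : PreComplex where
  B := Fin 5
  fB := inferInstance
  dB := inferInstance
  gr := ![0, 0, 0, -1, 1]
  alg := ![(n : ℤ), 0, -(n : ℤ), -(n : ℤ), (n : ℤ)]
  alex := ![-(n : ℤ), 0, (n : ℤ), -(n : ℤ), (n : ℤ)]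
  d := fun x y =>
    if (x.val = 4 ∧ y.val ≤ 2) ∨ ((x.val = 0 ∨ x.val = 2) ∧ y.val = 3)
    then 1 else 0

/-- `υ²(C) = Υ²_{C,1}(1)`. -/
noncomputable def upsilon2' (C : PreComplex) : EReal := C.Upsilon2 1 1

/-- The trivial (unit) model complex: a single generator of grading 0 at
bifiltration level (0,0) with vanishing differential. -/
def unitC : PreComplex where
  B := Fin 1
  fB := inferInstance
  dB := inferInstance
  gr := ![0]
  alg := ![0]
  alex := ![0]
  d := fun _ _ => 0

/-- `k`-fold tensor power of a pre-complex. -/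
def tpow (C : PreComplex) : ℕ → PreComplex
  | 0 => unitC
  | k + 1 => (tpow C k).tensor C

/-- The tensor product, over `n = 1, …, N`, of `a n` copies of `K_n`. -/
def bigTensor (N : ℕ) (a : ℕ → ℕ) : PreComplex :=
  (List.range N).foldl (fun acc k => acc.tensor (tpow (Kc (k + 1)) (a (k + 1)))) unitC

namespace PreComplex

open scoped Kronecker

lemma bigTensor_succ (N : ℕ) (a : ℕ → ℕ) :
    bigTensor (N + 1) a = (bigTensor N a).tensor (tpow (Kc (N + 1)) (a (N + 1))) := by
  simp [bigTensor, List.range_succ]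

/-- The differential of `C` as a matrix acting on row vectors. -/
def dMat (C : PreComplex) : Matrix C.B C.B (ZMod 2) := Matrix.of C.d

lemma bdry_eq_vecMul (C : PreComplex) (c : C.Chain) : C.bdry c = Matrix.vecMul c C.dMat := rfl

lemma dMat_tensor (C₁ C₂ : PreComplex) :
    (C₁.tensor C₂).dMat = C₁.dMat ⊗ₖ (1 : Matrix C₂.B C₂.B (ZMod 2)) +
      (1 : Matrix C₁.B C₁.B (ZMod 2)) ⊗ₖ C₂.dMat := by
  ext ⟨x₁, x₂⟩ ⟨y₁, y₂⟩
  change (if x₂ = y₂ then C₁.d x₁ y₁ else 0) + (if x₁ = y₁ then C₂.d x₂ y₂ else 0) =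
    C₁.d x₁ y₁ * (1 : Matrix C₂.B C₂.B (ZMod 2)) x₂ y₂ +
      (1 : Matrix C₁.B C₁.B (ZMod 2)) x₁ y₁ * C₂.d x₂ y₂
  simp [Matrix.one_apply]

/-- The tensor product of two contracting homotopies onto `E₁` and `E₂`. -/
lemma kronecker_homotopy {m n : Type} [Fintype m] [Fintype n] [DecidableEq m] [DecidableEq n]
    {d₁ h₁ E₁ : Matrix m m (ZMod 2)} {d₂ h₂ E₂ : Matrix n n (ZMod 2)}
    (e₁ : d₁ * h₁ + h₁ * d₁ = 1 + E₁) (e₂ : d₂ * h₂ + h₂ * d₂ = 1 + E₂)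
    (hdE : d₁ * E₁ = 0) (hEd : E₁ * d₁ = 0) :
    (d₁ ⊗ₖ (1 : Matrix n n (ZMod 2)) + (1 : Matrix m m (ZMod 2)) ⊗ₖ d₂) *
        (h₁ ⊗ₖ (1 : Matrix n n (ZMod 2)) + E₁ ⊗ₖ h₂) +
      (h₁ ⊗ₖ (1 : Matrix n n (ZMod 2)) + E₁ ⊗ₖ h₂) *
        (d₁ ⊗ₖ (1 : Matrix n n (ZMod 2)) + (1 : Matrix m m (ZMod 2)) ⊗ₖ d₂) =
      1 + E₁ ⊗ₖ E₂ := by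
  have two : ∀ A : Matrix (m × n) (m × n) (ZMod 2), A + A = 0 := fun A => by
    ext; exact CharTwo.add_self_eq_zero _
  have e₁' := congrArg (fun A => A ⊗ₖ (1 : Matrix n n (ZMod 2))) e₁
  have e₂' := congrArg (fun A => E₁ ⊗ₖ A) e₂
  simp only [Matrix.add_kronecker, Matrix.kronecker_add, Matrix.one_kronecker_one] at e₁' e₂'
  simp only [mul_add, add_mul, ← Matrix.mul_kronecker_mul, hdE, hEd, Matrix.zero_kronecker,
    one_mul, mul_one, add_zero, zero_add]
  calc _ = ((d₁ * h₁) ⊗ₖ (1 : Matrix n n (ZMod 2)) + (h₁ * d₁) ⊗ₖ (1 : Matrix n n (ZMod 2))) +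
        (E₁ ⊗ₖ (d₂ * h₂) + E₁ ⊗ₖ (h₂ * d₂)) + (h₁ ⊗ₖ d₂ + h₁ ⊗ₖ d₂) := by abel
    _ = 1 + E₁ ⊗ₖ E₂ + (E₁ ⊗ₖ (1 : Matrix n n (ZMod 2)) + E₁ ⊗ₖ (1 : Matrix n n (ZMod 2))) := by
      rw [e₁', e₂', two (h₁ ⊗ₖ d₂)]; abel
    _ = _ := by rw [two, add_zero]

/-- The elementary tensor of two chains. -/
def tensorChain {C₁ C₂ : PreComplex} (u : C₁.Chain) (v : C₂.Chain) : (C₁.tensor C₂).Chain :=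
  fun p => u p.1 * v p.2

lemma bdry_tensorChain {C₁ C₂ : PreComplex} (u : C₁.Chain) (v : C₂.Chain) :
    (C₁.tensor C₂).bdry (tensorChain u v) =
      tensorChain (C₁.bdry u) v + tensorChain u (C₂.bdry v) := by
  ext ⟨y₁, y₂⟩
  change ∑ x : C₁.B × C₂.B, u x.1 * v x.2 * ((if x.2 = y₂ then C₁.d x.1 y₁ else 0) +
    (if x.1 = y₁ then C₂.d x.2 y₂ else 0)) =
    (∑ x, u x * C₁.d x y₁) * v y₂ + u y₁ * ∑ x, v x * C₂.d x y₂
  simp only [Fintype.sum_prod_type, mul_add, Finset.sum_add_distrib, mul_ite, mul_zero,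
    Finset.sum_ite_eq', Finset.mem_univ, if_true, Finset.sum_mul, Finset.mul_sum]
  congr 1
  · exact Finset.sum_congr rfl fun _ _ => by ring
  · rw [Finset.sum_comm]
    simp only [Finset.sum_ite_eq', Finset.mem_univ, if_true]
    exact Finset.sum_congr rfl fun _ _ => by ring

lemma bdry_add (C : PreComplex) (u v : C.Chain) : C.bdry (u + v) = C.bdry u + C.bdry v :=
  Matrix.add_vecMul _ _ _

lemma bdry_single (C : PreComplex) (c y : C.B) : C.bdry (Pi.single c 1) y = C.d c y := by
  simp [bdry, Pi.single_apply]

lemma not_isBoundary_single {C : PreComplex} {c : C.B} (h : ∀ x, C.d x c = 0) :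
    ¬ C.isBoundary (Pi.single c 1) := by
  rintro ⟨w, hw⟩
  have := congrFun hw c
  simp [bdry, h] at this

/-- A deformation of `C` onto a one-dimensional complex, detected by a basis element `base` at
level `(0, 0)`, together with two generating cycles `zm`, `zp` lying on the antidiagonal and
a chain `w` of level at most `M` that connects them. -/
structure Core (C : PreComplex) (M : ℤ) where
  base : C.B
  alg_base : C.alg base = 0
  alex_base : C.alex base = 0
  d_base : ∀ x, C.d x base = 0
  zm : C.Chain
  zp : C.Chain
  w : C.Chain
  h : Matrix C.B C.B (ZMod 2)
  zm_base : zm base = 1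
  zp_base : zp base = 1
  zm_graded : C.isGraded zm 0
  zp_graded : C.isGraded zp 0
  zm_cycle : C.isCycle zm
  zp_cycle : C.isCycle zp
  zm_lev : ∀ x, zm x ≠ 0 → C.alg x ≤ 0 ∧ C.alg x + C.alex x = 0
  zp_lev : ∀ x, zp x ≠ 0 → C.alex x ≤ 0 ∧ C.alg x + C.alex x = 0
  bdry_w : C.bdry w = zm + zp
  w_lev : ∀ x, w x ≠ 0 → C.alg x + C.alex x ≤ 2 * M
  homotopy : C.dMat * h + h * C.dMat = 1 + Matrix.vecMulVec (Pi.single base 1) zm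

namespace Core

variable {C C₁ C₂ : PreComplex} {M : ℤ}

lemma bdry_base (K : Core C M) (c : C.Chain) : C.bdry c K.base = 0 := by
  simp [bdry, K.d_base]

lemma not_isBoundary (K : Core C M) {z : C.Chain} (hz : z K.base ≠ 0) : ¬ C.isBoundary z := by
  rintro ⟨w, rfl⟩
  exact hz (K.bdry_base w)

lemma isBoundary_of_base_eq_zero (K : Core C M) {z : C.Chain} (hz : C.isCycle z)
    (h0 : z K.base = 0) : C.isBoundary z := by
  refine ⟨Matrix.vecMul z K.h, ?_⟩
  have key := congrArg (Matrix.vecMul z) K.homotopy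
  rw [isCycle, bdry_eq_vecMul] at hz
  rw [Matrix.vecMul_add, Matrix.vecMul_add, ← Matrix.vecMul_vecMul, ← Matrix.vecMul_vecMul, hz,
    Matrix.zero_vecMul, zero_add, Matrix.vecMul_one, Matrix.vecMul_vecMulVec] at key
  rw [bdry_eq_vecMul, key]
  simp [h0]

lemma base_ne_zero (K : Core C M) {z : C.Chain} (hz : C.GenCycle z) : z K.base ≠ 0 :=
  fun h0 => hz.2.2 (K.isBoundary_of_base_eq_zero hz.1 h0)

lemma genCycle_zm (K : Core C M) : C.GenCycle K.zm :=
  ⟨K.zm_cycle, K.zm_graded, K.not_isBoundary (by simp [K.zm_base])⟩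

lemma genCycle_zp (K : Core C M) : C.GenCycle K.zp :=
  ⟨K.zp_cycle, K.zp_graded, K.not_isBoundary (by simp [K.zp_base])⟩

lemma fval_antidiagonal {t : ℝ} {i j : ℤ} (h : i + j = 0) : fval t (i, j) = (1 - t) * i := by
  have hj : (j : ℝ) = -i := by rw [eq_neg_of_add_eq_zero_right h]; push_cast; rfl
  simp only [fval, hj]
  ring

lemma inF_zm (K : Core C M) {t : ℝ} (ht : t ≤ 1) : C.inF t 0 K.zm := by
  intro x hx
  obtain ⟨h1, h2⟩ := K.zm_lev x hx
  rw [lev, fval_antidiagonal h2]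
  exact mul_nonpos_of_nonneg_of_nonpos (by linarith) (by exact_mod_cast h1)

lemma inF_zp (K : Core C M) {t : ℝ} (ht : 1 ≤ t) : C.inF t 0 K.zp := by
  intro x hx
  obtain ⟨h1, h2⟩ := K.zp_lev x hx
  rw [lev, fval_antidiagonal h2]
  have h3 : (0 : ℝ) ≤ C.alg x := by exact_mod_cast (by omega : (0 : ℤ) ≤ C.alg x)
  exact mul_nonpos_of_nonpos_of_nonneg (by linarith) h3

lemma gamma_eq_zero (K : Core C M) (t : ℝ) : C.gamma t = 0 := by
  refine IsLeast.csInf_eq ⟨?_, ?_⟩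
  · rcases le_total t 1 with ht | ht
    · exact ⟨K.zm, K.genCycle_zm, K.inF_zm ht⟩
    · exact ⟨K.zp, K.genCycle_zp, K.inF_zp ht⟩
  · rintro s ⟨z, hz, hs⟩
    have := hs K.base (K.base_ne_zero hz)
    simpa [lev, fval, K.alg_base, K.alex_base] using this

lemma zm_mem (K : Core C M) : K.zm ∈ C.Zminus 1 :=
  ⟨1, one_pos, fun δ hδ _ => ⟨K.genCycle_zm, by
    rw [K.gamma_eq_zero]; exact K.inF_zm (by linarith)⟩⟩

lemma zp_mem (K : Core C M) : K.zp ∈ C.Zplus 1 :=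
  ⟨1, one_pos, fun δ hδ _ => ⟨K.genCycle_zp, by
    rw [K.gamma_eq_zero]; exact K.inF_zp (by linarith)⟩⟩

lemma mem_gamma2Set (K : Core C M) : (M : ℝ) ∈ C.gamma2Set 1 1 := by
  refine ⟨K.zm, K.zm_mem, K.zp, K.zp_mem, fun x hx => Or.inl ?_, fun x hx => Or.inl ?_, K.w,
    fun x hx => Or.inr ?_, K.bdry_w⟩
  · rw [K.gamma_eq_zero]; exact K.inF_zm le_rfl x hx
  · rw [K.gamma_eq_zero]; exact K.inF_zp le_rfl x hx
  · have h : (C.alg x : ℝ) + C.alex x ≤ 2 * M := by exact_mod_cast K.w_lev x hx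
    simp only [fval, lev]
    linarith

/-- Weakening the bound on the connecting chain. -/
def mono (K : Core C M) {M' : ℤ} (h : M ≤ M') : Core C M' :=
  { K with w_lev := fun x hx => (K.w_lev x hx).trans (by linarith) }

/-- The core of a tensor product. -/
def tensor (K₁ : Core C₁ M) (K₂ : Core C₂ M) : Core (C₁.tensor C₂) M where
  base := (K₁.base, K₂.base)
  alg_base := by simp [PreComplex.tensor, K₁.alg_base, K₂.alg_base]
  alex_base := by simp [PreComplex.tensor, K₁.alex_base, K₂.alex_base]
  d_base x := by simp [PreComplex.tensor, K₁.d_base, K₂.d_base]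
  zm := tensorChain K₁.zm K₂.zm
  zp := tensorChain K₁.zp K₂.zp
  w := tensorChain K₁.w K₂.zm + tensorChain K₁.zp K₂.w
  h := K₁.h ⊗ₖ (1 : Matrix C₂.B C₂.B (ZMod 2)) +
    Matrix.vecMulVec (Pi.single K₁.base 1) K₁.zm ⊗ₖ K₂.h
  zm_base := by simp [tensorChain, K₁.zm_base, K₂.zm_base]
  zp_base := by simp [tensorChain, K₁.zp_base, K₂.zp_base]
  zm_graded x hx := by
    have h1 := K₁.zm_graded x.1 (left_ne_zero_of_mul hx)
    have h2 := K₂.zm_graded x.2 (right_ne_zero_of_mul hx)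
    simp [PreComplex.tensor, h1, h2]
  zp_graded x hx := by
    have h1 := K₁.zp_graded x.1 (left_ne_zero_of_mul hx)
    have h2 := K₂.zp_graded x.2 (right_ne_zero_of_mul hx)
    simp [PreComplex.tensor, h1, h2]
  zm_cycle := by
    have h1 : C₁.bdry K₁.zm = 0 := K₁.zm_cycle
    have h2 : C₂.bdry K₂.zm = 0 := K₂.zm_cycle
    rw [isCycle, bdry_tensorChain, h1, h2]
    ext p
    simp [tensorChain]
  zp_cycle := by
    have h1 : C₁.bdry K₁.zp = 0 := K₁.zp_cycle
    have h2 : C₂.bdry K₂.zp = 0 := K₂.zp_cycle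
    rw [isCycle, bdry_tensorChain, h1, h2]
    ext p
    simp [tensorChain]
  zm_lev x hx := by
    have h1 := K₁.zm_lev x.1 (left_ne_zero_of_mul hx)
    have h2 := K₂.zm_lev x.2 (right_ne_zero_of_mul hx)
    simp only [PreComplex.tensor]
    omega
  zp_lev x hx := by
    have h1 := K₁.zp_lev x.1 (left_ne_zero_of_mul hx)
    have h2 := K₂.zp_lev x.2 (right_ne_zero_of_mul hx)
    simp only [PreComplex.tensor]
    omega
  bdry_w := by
    have h1 : C₁.bdry K₁.zp = 0 := K₁.zp_cycle
    have h2 : C₂.bdry K₂.zm = 0 := K₂.zm_cycle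
    rw [bdry_add, bdry_tensorChain, bdry_tensorChain, h1, h2, K₁.bdry_w, K₂.bdry_w]
    ext p
    have h3 := CharTwo.add_self_eq_zero (K₁.zp p.1 * K₂.zm p.2)
    simp only [tensorChain, Pi.add_apply, Pi.zero_apply]
    linear_combination h3
  w_lev x hx := by
    simp only [PreComplex.tensor]
    by_cases hx' : tensorChain K₁.w K₂.zm x = 0
    · have hy : tensorChain K₁.zp K₂.w x ≠ 0 := fun h => hx (by simp [hx', h])
      have h1 := K₁.zp_lev x.1 (left_ne_zero_of_mul hy)
      have h2 := K₂.w_lev x.2 (right_ne_zero_of_mul hy)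
      omega
    · have h1 := K₁.w_lev x.1 (left_ne_zero_of_mul hx')
      have h2 := K₂.zm_lev x.2 (right_ne_zero_of_mul hx')
      omega
  homotopy := by
    set E₁ := Matrix.vecMulVec (Pi.single K₁.base (1 : ZMod 2)) K₁.zm with hE₁
    set E₂ := Matrix.vecMulVec (Pi.single K₂.base (1 : ZMod 2)) K₂.zm with hE₂
    have hdE : C₁.dMat * E₁ = 0 := by
      rw [hE₁, Matrix.mul_vecMulVec]
      ext x y
      simp [Matrix.vecMulVec_apply, dMat, K₁.d_base]
    have hEd : E₁ * C₁.dMat = 0 := by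
      have hz : Matrix.vecMul K₁.zm C₁.dMat = 0 := K₁.zm_cycle
      rw [hE₁, Matrix.vecMulVec_mul, hz]
      ext x y
      simp [Matrix.vecMulVec_apply]
    have hE : Matrix.vecMulVec (Pi.single (K₁.base, K₂.base) (1 : ZMod 2))
        (tensorChain K₁.zm K₂.zm) = E₁ ⊗ₖ E₂ := by
      ext ⟨x₁, x₂⟩ ⟨y₁, y₂⟩
      change (Pi.single (K₁.base, K₂.base) (1 : ZMod 2) : C₁.B × C₂.B → ZMod 2) (x₁, x₂) *
        (K₁.zm y₁ * K₂.zm y₂) =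
        (Pi.single K₁.base (1 : ZMod 2) : C₁.B → ZMod 2) x₁ * K₁.zm y₁ *
          ((Pi.single K₂.base (1 : ZMod 2) : C₂.B → ZMod 2) x₂ * K₂.zm y₂)
      by_cases h₁ : x₁ = K₁.base <;> by_cases h₂ : x₂ = K₂.base <;> simp [h₁, h₂]
    refine Eq.trans ?_ (congrArg (fun A => 1 + A) hE.symm)
    rw [dMat_tensor]
    exact kronecker_homotopy K₁.homotopy K₂.homotopy hdE hEd

/-- The core of the unit complex. -/
def unit : Core unitC 0 where
  base := (0 : Fin 1)
  alg_base := rfl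
  alex_base := rfl
  d_base _ := rfl
  zm := fun _ => 1
  zp := fun _ => 1
  w := 0
  h := 0
  zm_base := rfl
  zp_base := rfl
  zm_graded x _ := by fin_cases x; rfl
  zp_graded x _ := by fin_cases x; rfl
  zm_cycle := by ext; simp [bdry, unitC]
  zp_cycle := by ext; simp [bdry, unitC]
  zm_lev x _ := by fin_cases x; decide
  zp_lev x _ := by fin_cases x; decide
  bdry_w := by
    ext
    simpa [bdry] using (CharTwo.add_self_eq_zero (1 : ZMod 2)).symm
  w_lev x hx := absurd rfl hx
  homotopy := by
    rw [mul_zero, zero_mul, add_zero]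
    exact (by decide : (0 : Matrix (Fin 1) (Fin 1) (ZMod 2)) =
      1 + Matrix.vecMulVec (Pi.single (0 : Fin 1) 1) (fun _ : Fin 1 => 1))

/-- The matrix of the differential of `K_n`, which does not depend on `n`. -/
def KcMatrix : Matrix (Fin 5) (Fin 5) (ZMod 2) :=
  !![0, 0, 0, 0, 1; 0, 0, 0, 0, 1; 0, 0, 0, 0, 1; 1, 0, 1, 0, 0; 0, 0, 0, 0, 0]

/-- A homotopy contracting `K_n` onto the span of `a + b`. -/
def KcHomotopy : Matrix (Fin 5) (Fin 5) (ZMod 2) :=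
  !![0, 0, 0, 0, 0; 0, 0, 0, 0, 0; 0, 0, 0, 1, 0; 0, 0, 0, 0, 0; 1, 0, 0, 0, 0]

lemma dMat_Kc (n : ℕ) : (Kc n).dMat = KcMatrix := by
  ext x y
  fin_cases x <;> fin_cases y <;> rfl

lemma bdry_Kc (n : ℕ) (u : Fin 5 → ZMod 2) : (Kc n).bdry u = Matrix.vecMul u KcMatrix :=
  congrArg (Matrix.vecMul (m := Fin 5) (n := Fin 5) u) (dMat_Kc n)

lemma KcMatrix_homotopy : KcMatrix * KcHomotopy + KcHomotopy * KcMatrix =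
    1 + Matrix.vecMulVec (Pi.single 1 1) ![1, 1, 0, 0, 0] := by
  decide

/-- The core of `K_n`, with base `b`, cycles `a + b` and `b + c`, and connecting chain `x`. -/
def ofKc (n : ℕ) : Core (Kc n) n where
  base := (1 : Fin 5)
  alg_base := rfl
  alex_base := rfl
  d_base x := by fin_cases x <;> rfl
  zm := ![1, 1, 0, 0, 0]
  zp := ![0, 1, 1, 0, 0]
  w := ![0, 0, 0, 1, 0]
  h := KcHomotopy
  zm_base := rfl
  zp_base := rfl
  zm_graded x hx := by fin_cases x <;> first | rfl | exact absurd rfl hx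
  zp_graded x hx := by fin_cases x <;> first | rfl | exact absurd rfl hx
  zm_cycle :=
    (bdry_Kc n _).trans (by decide : Matrix.vecMul ![1, 1, 0, 0, 0] KcMatrix = 0)
  zp_cycle :=
    (bdry_Kc n _).trans (by decide : Matrix.vecMul ![0, 1, 1, 0, 0] KcMatrix = 0)
  zm_lev x hx := by
    fin_cases x <;> first | exact absurd rfl hx | simp [Kc]
  zp_lev x hx := by
    fin_cases x <;> first | exact absurd rfl hx | simp [Kc]
  bdry_w :=
    (bdry_Kc n _).trans (by decide : Matrix.vecMul ![0, 0, 0, 1, 0] KcMatrix =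
      ![1, 1, 0, 0, 0] + ![0, 1, 1, 0, 0])
  w_lev x hx := by
    fin_cases x <;> first | exact absurd rfl hx | simp [Kc, two_mul]
  homotopy := by
    rw [dMat_Kc]
    exact KcMatrix_homotopy

/-- The core of a tensor power. -/
def pow (K : Core C M) (hM : 0 ≤ M) : ∀ k : ℕ, Core (tpow C k) M
  | 0 => unit.mono hM
  | k + 1 => (K.pow hM k).tensor K

lemma nonempty_bigTensor (a : ℕ → ℕ) (N : ℕ) : Nonempty (Core (bigTensor N a) N) := by
  induction N with
  | zero => exact ⟨unit⟩
  | succ N ih =>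
    obtain ⟨K⟩ := ih
    rw [bigTensor_succ]
    exact ⟨(K.mono (by simp)).tensor ((ofKc (N + 1)).pow (by positivity) _)⟩

end Core

/-- A copy of `K_n` inside `C` such that restriction of chains to it is a chain map
`C → K_n` preserving levels, with `b` sent to `base`. -/
structure Restricts (C : PreComplex) (n : ℕ) (base : C.B) where
  e : Fin 5 → C.B
  e_base : e 1 = base
  alg_e : ∀ v, C.alg (e v) = (Kc n).alg v
  alex_e : ∀ v, C.alex (e v) = (Kc n).alex v
  bdry_e : ∀ (z : C.Chain) (v : Fin 5), C.bdry z (e v) = (Kc n).bdry (fun u => z (e u)) v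

namespace Restricts

variable {C C₁ C₂ : PreComplex} {M : ℤ} {n : ℕ}

/-- `K_n` restricts to itself. -/
def refl (n : ℕ) : Restricts (Kc n) n (Core.ofKc n).base where
  e := id
  e_base := rfl
  alg_e _ := rfl
  alex_e _ := rfl
  bdry_e _ _ := rfl

/-- A restriction onto `K_n` extends to a tensor product with a complex having a core. -/
def tensor {K₂ : Core C₂ M} (R : Restricts C₂ n K₂.base) (K₁ : Core C₁ M) :
    Restricts (C₁.tensor C₂) n (K₁.tensor K₂).base where
  e v := (K₁.base, R.e v)
  e_base := by rw [R.e_base]; rfl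
  alg_e v := by simp [PreComplex.tensor, K₁.alg_base, R.alg_e]
  alex_e v := by simp [PreComplex.tensor, K₁.alex_base, R.alex_e]
  bdry_e z v := by
    refine Eq.trans ?_ (R.bdry_e (fun y => z (K₁.base, y)) v)
    change ∑ x : C₁.B × C₂.B, z x * ((if x.2 = R.e v then C₁.d x.1 K₁.base else 0) +
      (if x.1 = K₁.base then C₂.d x.2 (R.e v) else 0)) =
      ∑ y, z (K₁.base, y) * C₂.d y (R.e v)
    simp only [K₁.d_base, ite_self, zero_add, Fintype.sum_prod_type, mul_ite, mul_zero]
    rw [Finset.sum_comm]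
    simp

lemma bdry_e_two {β : C.B} (R : Restricts C n β) (z : C.Chain) : C.bdry z (R.e 2) = z (R.e 3) := by
  rw [R.bdry_e]
  change ∑ u : Fin 5, z (R.e u) * (Kc n).d u (2 : Fin 5) = _
  simp [Kc, Fin.sum_univ_five]

lemma bdry_e_four {β : C.B} (R : Restricts C n β) (z : C.Chain) :
    C.bdry z (R.e 4) = z (R.e 0) + z β + z (R.e 2) := by
  rw [R.bdry_e]
  change ∑ u : Fin 5, z (R.e u) * (Kc n).d u (4 : Fin 5) = _
  simp [Kc, Fin.sum_univ_five, R.e_base]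

lemma lev_e_zero {β : C.B} (R : Restricts C n β) : C.lev (R.e 0) = (-(n : ℤ), (n : ℤ)) :=
  Prod.ext (R.alg_e 0) (R.alex_e 0)

lemma lev_e_two {β : C.B} (R : Restricts C n β) : C.lev (R.e 2) = ((n : ℤ), -(n : ℤ)) :=
  Prod.ext (R.alg_e 2) (R.alex_e 2)

lemma lev_e_three {β : C.B} (R : Restricts C n β) : C.lev (R.e 3) = ((n : ℤ), (n : ℤ)) :=
  Prod.ext (R.alg_e 3) (R.alex_e 3)

variable {K : Core C M}

lemma zminus_e_two (R : Restricts C n K.base) (hn : 0 < n) {z : C.Chain} (hz : z ∈ C.Zminus 1) :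
    z (R.e 2) = 0 := by
  obtain ⟨δ₀, hδ₀, H⟩ := hz
  obtain ⟨-, hF⟩ := H (δ₀ / 2) (by linarith) (by linarith)
  by_contra hne
  have h := hF _ hne
  rw [K.gamma_eq_zero, R.lev_e_two, Core.fval_antidiagonal (add_neg_cancel _)] at h
  have : 0 < δ₀ / 2 * (n : ℝ) := by positivity
  push_cast at h
  linarith

lemma zplus_e_two (R : Restricts C n K.base) (hn : 0 < n) {z : C.Chain} (hz : z ∈ C.Zplus 1) :
    z (R.e 2) ≠ 0 := by
  obtain ⟨δ₀, hδ₀, H⟩ := hz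
  obtain ⟨hgen, hF⟩ := H (δ₀ / 2) (by linarith) (by linarith)
  have h0 : z (R.e 0) = 0 := by
    by_contra hne
    have h := hF _ hne
    rw [K.gamma_eq_zero, R.lev_e_zero, Core.fval_antidiagonal (neg_add_cancel _)] at h
    have : 0 < δ₀ / 2 * (n : ℝ) := by positivity
    push_cast at h
    linarith
  intro h2
  have h4 := R.bdry_e_four z
  rw [h0, h2, show C.bdry z = 0 from hgen.1] at h4
  exact K.base_ne_zero hgen (by simpa using h4.symm)

lemma le_of_mem_gamma2Set (R : Restricts C n K.base) (hn : 0 < n) {r : ℝ}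
    (hr : r ∈ C.gamma2Set 1 1) : (n : ℝ) ≤ r := by
  obtain ⟨zm, hzm, zp, hzp, -, -, w, hw, hbd⟩ := hr
  have h3 : w (R.e 3) ≠ 0 := by
    rw [← R.bdry_e_two w, hbd, Pi.add_apply, R.zminus_e_two hn hzm, zero_add]
    exact R.zplus_e_two hn hzp
  have hpos : (0 : ℝ) < n := by exact_mod_cast hn
  have hval : fval 1 ((n : ℤ), (n : ℤ)) = n := by simp only [fval]; push_cast; ring
  rcases hw _ h3 with h | h
  · rw [R.lev_e_three, K.gamma_eq_zero, hval] at h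
    linarith
  · rwa [R.lev_e_three, hval] at h

lemma upsilon2_eq {K : Core C n} (R : Restricts C n K.base) (hn : 0 < n) :
    upsilon2' C = ((-2 * (n : ℝ) : ℝ) : EReal) := by
  have hmem : (n : ℝ) ∈ C.gamma2Set 1 1 := by simpa using K.mem_gamma2Set
  have hg : C.gamma2 1 1 = ((n : ℝ) : EReal) := by
    refine IsLeast.csInf_eq ⟨⟨_, hmem, rfl⟩, ?_⟩
    rintro _ ⟨r, hr, rfl⟩
    exact EReal.coe_le_coe_iff.2 (R.le_of_mem_gamma2Set hn hr)
  rw [upsilon2', Upsilon2, hg, K.gamma_eq_zero, ← EReal.coe_sub, sub_zero, EReal.coe_mul]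
  rfl

lemma not_stablyEquiv_unitC (R : Restricts C n K.base) (hn : 0 < n) :
    ¬ C.StablyEquiv unitC := by
  rintro ⟨A₁, A₂, hA₁, -, e, -, halg, -, hd⟩
  obtain ⟨q, hq⟩ := e.surjective (Sum.inl (0 : Fin 1))
  have hout : ∀ y, (C.dsum A₁).d q y = 0 := fun y => by
    rw [← hd, hq]
    cases e y <;> rfl
  have hin : ∀ x, (C.dsum A₁).d x q = 0 := fun x => by
    rw [← hd, hq]
    cases e x <;> rfl
  have hqalg : (C.dsum A₁).alg q = 0 := by rw [← halg, hq]; rfl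
  rcases q with c | c
  · have hcyc : C.isCycle (Pi.single c 1) := by
      ext y
      rw [bdry_single]
      exact hout (Sum.inl y)
    have hc : (Pi.single c 1 : C.Chain) K.base ≠ 0 := fun h =>
      not_isBoundary_single (fun x => hin (Sum.inl x)) (K.isBoundary_of_base_eq_zero hcyc h)
    have hne : ∀ v, (Kc n).alg v ≠ 0 → (Pi.single c 1 : C.Chain) (R.e v) = 0 := by
      intro v hv
      refine Pi.single_eq_of_ne ?_ _
      rintro rfl
      exact hv ((R.alg_e v).symm.trans hqalg)
    have hn' : (n : ℤ) ≠ 0 := by exact_mod_cast hn.ne'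
    have h4 := R.bdry_e_four (Pi.single c 1)
    rw [hne (0 : Fin 5) (neg_ne_zero.2 hn'), hne (2 : Fin 5) hn',
      show C.bdry (Pi.single c 1) = 0 from hcyc] at h4
    exact hc (by simpa using h4.symm)
  · refine not_isBoundary_single (fun x => hin (Sum.inr x)) (hA₁.2.2 (Pi.single c 1) ?_)
    ext y
    rw [bdry_single]
    exact hout (Sum.inr y)

lemma exists_bigTensor {N : ℕ} (hN : 1 ≤ N) (a : ℕ → ℕ) (haN : 0 < a N) :
    ∃ K : Core (bigTensor N a) N, Nonempty (Restricts (bigTensor N a) N K.base) := by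
  obtain ⟨m, rfl⟩ := Nat.exists_eq_succ_of_ne_zero (by omega : N ≠ 0)
  obtain ⟨k, hk⟩ := Nat.exists_eq_succ_of_ne_zero haN.ne'
  obtain ⟨K⟩ := Core.nonempty_bigTensor a m
  rw [Nat.succ_eq_add_one] at hk ⊢
  rw [bigTensor_succ, hk]
  let K' : Core (bigTensor m a) ((m + 1 : ℕ) : ℤ) := K.mono (by simp)
  exact ⟨K'.tensor (((Core.ofKc (m + 1)).pow (by positivity) k).tensor (Core.ofKc (m + 1))),
    ⟨((refl (m + 1)).tensor ((Core.ofKc (m + 1)).pow (by positivity) k)).tensor K'⟩⟩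

end Restricts

end PreComplex

/-- if `a_N > 0` and `D = ⊗_{n=1}^N K_n^{⊗ a_n}` then
`υ²(D) = −2N`; consequently `D` is not stably trivial, so the complexes `K_n`
are linearly independent in the group of stable equivalence classes. -/
theorem upsilon2_bigTensor (N : ℕ) (hN : 1 ≤ N) (a : ℕ → ℕ) (haN : 0 < a N) :
    upsilon2' (bigTensor N a) = ((-2 * (N : ℝ) : ℝ) : EReal) ∧
    ¬ (bigTensor N a).StablyEquiv unitC := by
  obtain ⟨K, ⟨R⟩⟩ := PreComplex.Restricts.exists_bigTensor hN a haN
  exact ⟨R.upsilon2_eq hN, R.not_stablyEquiv_unitC hN⟩
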